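/- Let q be a prime and k ≥ 1. There is no family of q-product blocks B_0, ..., B_{q-1} over ZMod q such that every block has exactly k elements and the union of all the blocks has exactly k+1 elements. In other words, no (q,k,k+1)-PB exists. -/

import Mathlib

/-- For a prime `q` and `k ≥ 1` there is no `(q, k, k+1)`-PB: no family of `q`-product
blocks in which every block has exactly `k` elements and the union of all blocks has
exactly `k + 1` elements. -/
theorem no_q_k_kplus1_product_blocks (q k : ℕ) [Fact q.Prime] (hk : 1 ≤ k) :
    ¬ ∃ B : ZMod q → Finset (ZMod q),
      (∀ r s : ZMod q, ∀ a ∈ B r, ∀ b ∈ B s, (b - a) * (s - r) ≠ 1) ∧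
      (∀ s : ZMod q, (B s).card = k) ∧
      (Finset.univ.biUnion B).card = k + 1 := by
  rintro ⟨B, hB, hcard, hT⟩
  obtain ⟨a, ha, b, hb, hab⟩ :=
    Finset.one_lt_card.1 (show 1 < (Finset.univ.biUnion B).card by omega)
  have hd : b - a ≠ 0 := sub_ne_zero.2 hab.symm
  obtain ⟨s, -, hs⟩ := Finset.mem_biUnion.1 ha
  obtain ⟨t, -, ht⟩ := Finset.mem_biUnion.1 hb
  have not_mem_shift : ∀ r, a ∈ B r → b ∉ B (r + (b - a)⁻¹) := fun r hr hbr =>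
    hB r _ a hr b hbr (by rw [add_sub_cancel_left, mul_inv_cancel₀ hd])
  have mem_of_not_mem : ∀ r, b ∉ B r → a ∈ B r := by
    intro r hr
    have heq : B r = (Finset.univ.biUnion B).erase b := by
      apply Finset.eq_of_subset_of_card_le
      · exact Finset.subset_erase.2 ⟨Finset.subset_biUnion_of_mem B (Finset.mem_univ r), hr⟩
      · rw [Finset.card_erase_of_mem hb, hT, hcard, Nat.add_sub_cancel]
    rw [heq]
    exact Finset.mem_erase.2 ⟨hab, ha⟩
  have mem_add_mul : ∀ n : ℕ, a ∈ B (s + n * (b - a)⁻¹) := by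
    intro n
    induction n with
    | zero => simpa using hs
    | succ n ih =>
      have h := mem_of_not_mem _ (not_mem_shift _ ih)
      rwa [add_assoc, ← add_one_mul, ← Nat.cast_succ] at h
  have mem_all : ∀ r, a ∈ B r := by
    intro r
    have h := mem_add_mul ((r - s) * (b - a)).val
    rwa [ZMod.natCast_zmod_val, mul_assoc, mul_inv_cancel₀ hd, mul_one,
      add_sub_cancel] at h
  refine not_mem_shift (t - (b - a)⁻¹) (mem_all _) ?_
  rwa [sub_add_cancel]
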